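/- Let n ≥ 2 and let X_1,…,X_n be independent standard normal random variables, M_n = max_{1≤i≤n} X_i. Then there exists a universal constant c > 0 such that for all t ≥ 0, P(|M_n − E[M_n]| ≥ t) ≤ 6 e^{−c t √(log n)}. -/

import Mathlib

open MeasureTheory ProbabilityTheory Real

lemma gaussianReal_real_eq_setIntegral (m : ℝ) (s : Set ℝ) :
    (gaussianReal m 1).real s = ∫ x in s, gaussianPDFReal m 1 x := by
  rw [measureReal_def, gaussianReal_apply_eq_integral _ one_ne_zero,
    ENNReal.toReal_ofReal (integral_nonneg fun x ↦ gaussianPDFReal_nonneg _ _ _)]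

/-- Shifting a standard Gaussian tail by `s ≥ 0` costs at least a factor `exp (-a s - s² / 2)`. -/
lemma gaussianReal_Ici_add_le (a : ℝ) {s : ℝ} (hs : 0 ≤ s) :
    (gaussianReal 0 1).real (Set.Ici (a + s)) ≤
      exp (-(a * s) - s ^ 2 / 2) * (gaussianReal 0 1).real (Set.Ici a) := by
  have hshift : (gaussianReal 0 1).real (Set.Ici (a + s)) =
      (gaussianReal (-s) 1).real (Set.Ici a) := by
    have h := gaussianReal_map_sub_const (μ := 0) (v := 1) s
    rw [zero_sub] at h
    rw [← h, map_measureReal_apply (by fun_prop) measurableSet_Ici]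
    congr 1
    ext x
    simp
  rw [hshift, gaussianReal_real_eq_setIntegral, gaussianReal_real_eq_setIntegral,
    ← integral_const_mul]
  refine setIntegral_mono_on (integrable_gaussianPDFReal _ _).integrableOn
    ((integrable_gaussianPDFReal _ _).const_mul _).integrableOn measurableSet_Ici
    fun x hx ↦ ?_
  have hx : a ≤ x := hx
  simp only [gaussianPDFReal, NNReal.coe_one, mul_one]
  rw [mul_left_comm, ← exp_add]
  gcongr
  nlinarith [mul_nonneg (sub_nonneg.2 hx) hs]

lemma continuous_gaussianReal_Ici : Continuous fun x ↦ (gaussianReal 0 1).real (Set.Ici x) := by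
  have h : (fun x ↦ (gaussianReal 0 1).real (Set.Ici x)) =
      fun x ↦ (gaussianReal 0 1).real (Set.Ici 0) - ∫ y in (0 : ℝ)..x, gaussianPDFReal 0 1 y := by
    ext x
    have hint := integrable_gaussianPDFReal 0 1
    rw [gaussianReal_real_eq_setIntegral, gaussianReal_real_eq_setIntegral,
      integral_Ici_eq_integral_Ioi, integral_Ici_eq_integral_Ioi, eq_sub_iff_add_eq,
      add_comm]
    exact intervalIntegral.integral_interval_add_Ioi hint.integrableOn hint.integrableOn
  rw [h]
  exact continuous_const.sub (intervalIntegral.continuous_primitive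
    (fun a b ↦ (integrable_gaussianPDFReal 0 1).intervalIntegrable) 0)

lemma gaussianReal_Iic_eq (x : ℝ) :
    (gaussianReal 0 1).real (Set.Iic x) = (gaussianReal 0 1).real (Set.Ici (-x)) := by
  have h := gaussianReal_map_neg (μ := 0) (v := 1)
  rw [neg_zero] at h
  conv_lhs => rw [← h, map_measureReal_apply (by fun_prop) measurableSet_Iic]
  congr 1
  ext y
  simp

lemma gaussianReal_Iic_eq_one_sub (x : ℝ) :
    (gaussianReal 0 1).real (Set.Iic x) = 1 - (gaussianReal 0 1).real (Set.Ici x) := by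
  have := nullSingletonClass_gaussianReal (μ := 0) (v := 1) one_ne_zero
  rw [← measureReal_congr Iio_ae_eq_Iic, ← Set.compl_Ici,
    probReal_compl_eq_one_sub measurableSet_Ici]

lemma gaussianReal_Ici_le {x : ℝ} (hx : 0 ≤ x) :
    (gaussianReal 0 1).real (Set.Ici x) ≤ exp (-(x ^ 2 / 2)) / 2 := by
  have h0 : (gaussianReal 0 1).real (Set.Ici 0) = 1 / 2 := by
    have h1 := gaussianReal_Iic_eq 0
    have h2 := gaussianReal_Iic_eq_one_sub 0
    rw [neg_zero] at h1
    linarith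
  have h := gaussianReal_Ici_add_le 0 hx
  rw [h0] at h
  simpa [div_eq_mul_inv] using h

lemma le_gaussianReal_Ici {x : ℝ} (hx : 0 ≤ x) :
    exp (-x ^ 2) / 8 ≤ (gaussianReal 0 1).real (Set.Ici x) := by
  have hc : exp (-x ^ 2) / 8 ≤ (√(2 * π))⁻¹ * exp (-(x + 1) ^ 2 / 2) := by
    have h1 : exp (-x ^ 2) * exp (-1) ≤ exp (-(x + 1) ^ 2 / 2) := by
      rw [← exp_add]
      gcongr
      nlinarith [sq_nonneg (x - 1)]
    have h2 : √(2 * π) ≤ 2.6 := by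
      rw [sqrt_le_left (by norm_num)]
      nlinarith [pi_lt_d2]
    have h3 : (1 : ℝ) / 8 ≤ (√(2 * π))⁻¹ * exp (-1) := by
      rw [exp_neg, ← mul_inv, ← one_div]
      have := exp_one_lt_d9
      have h4 : 0 < √(2 * π) := by positivity
      gcongr
      nlinarith [exp_pos 1]
    calc exp (-x ^ 2) / 8 = exp (-x ^ 2) * (1 / 8) := by ring
      _ ≤ exp (-x ^ 2) * ((√(2 * π))⁻¹ * exp (-1)) := by gcongr
      _ = (√(2 * π))⁻¹ * (exp (-x ^ 2) * exp (-1)) := by ring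
      _ ≤ _ := by gcongr
  calc exp (-x ^ 2) / 8 = ∫ _ in Set.Icc x (x + 1), exp (-x ^ 2) / 8 := by simp
    _ ≤ ∫ y in Set.Icc x (x + 1), gaussianPDFReal 0 1 y := by
      refine setIntegral_mono_on (by simp) (integrable_gaussianPDFReal _ _).integrableOn
        measurableSet_Icc fun y hy ↦ hc.trans ?_
      have h1 := hy.1
      have h2 := hy.2
      simp only [gaussianPDFReal, NNReal.coe_one, mul_one, sub_zero]
      gcongr
      linarith
    _ = (gaussianReal 0 1).real (Set.Icc x (x + 1)) := (gaussianReal_real_eq_setIntegral _ _).symm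
    _ ≤ _ := measureReal_mono Set.Icc_subset_Ici_self

/-- The quantile of order `1 - 1 / (8 n)` of the standard Gaussian is comparable to `√(log n)`. -/
lemma exists_gaussianReal_Ici_eq {n : ℕ} (hn : 2 ≤ n) :
    ∃ a : ℝ, √(log n) ≤ a ∧ a ≤ √8 * √(log n) ∧
      (gaussianReal 0 1).real (Set.Ici a) = 1 / (8 * n) := by
  have hn' : (2 : ℝ) ≤ n := by exact_mod_cast hn
  have hlog : 0 ≤ log n := log_nonneg (by linarith)
  have hlow : 1 / (8 * n) ≤ (gaussianReal 0 1).real (Set.Ici √(log n)) := by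
    refine le_trans (le_of_eq ?_) (le_gaussianReal_Ici (sqrt_nonneg _))
    rw [sq_sqrt hlog, exp_neg, exp_log (by linarith)]
    field_simp
  have hhigh : (gaussianReal 0 1).real (Set.Ici (√8 * √(log n))) ≤ 1 / (8 * n) := by
    refine (gaussianReal_Ici_le (by positivity)).trans ?_
    rw [mul_pow, sq_sqrt hlog, sq_sqrt (by norm_num), show 8 * log n / 2 = (4 : ℕ) * log n by
      push_cast; ring, exp_neg, exp_nat_mul, exp_log (by linarith), div_le_div_iff₀ two_pos
      (by positivity), inv_mul_le_iff₀ (by positivity)]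
    have : (2 : ℝ) ^ 3 ≤ n ^ 3 := by gcongr
    nlinarith
  have hab : √(log n) ≤ √8 * √(log n) :=
    le_mul_of_one_le_left (sqrt_nonneg _) (one_le_sqrt.2 (by norm_num))
  obtain ⟨a, ha, h⟩ := intermediate_value_Icc' hab continuous_gaussianReal_Ici.continuousOn
    ⟨hhigh, hlow⟩
  exact ⟨a, ha.1, ha.2, h⟩

section Maximum

variable {Ω : Type*} [MeasurableSpace Ω] {P : Measure Ω} [IsProbabilityMeasure P] {n : ℕ}
  {X : Fin n → Ω → ℝ}

lemma measureReal_le_iSup_le (hn : 0 < n) (hX : ∀ i, Measurable (X i))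
    (hlaw : ∀ i, P.map (X i) = gaussianReal 0 1) (x : ℝ) :
    P.real {ω | x ≤ ⨆ i, X i ω} ≤ n * (gaussianReal 0 1).real (Set.Ici x) := by
  have : Nonempty (Fin n) := ⟨⟨0, hn⟩⟩
  have hsub : {ω | x ≤ ⨆ i, X i ω} ⊆ ⋃ i, X i ⁻¹' Set.Ici x := by
    intro ω hω
    obtain ⟨i, hi⟩ := exists_eq_ciSup_of_finite (f := fun i ↦ X i ω)
    exact Set.mem_iUnion.2 ⟨i, show x ≤ X i ω from hi ▸ hω⟩
  refine (measureReal_mono hsub).trans ((measureReal_iUnion_fintype_le _).trans (le_of_eq ?_))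
  simp [← map_measureReal_apply (hX _) measurableSet_Ici, hlaw]

lemma measureReal_iSup_le_le (hX : ∀ i, Measurable (X i)) (hindep : iIndepFun X P)
    (hlaw : ∀ i, P.map (X i) = gaussianReal 0 1) (x : ℝ) :
    P.real {ω | ⨆ i, X i ω ≤ x} ≤ (gaussianReal 0 1).real (Set.Iic x) ^ n := by
  have hsub : {ω | ⨆ i, X i ω ≤ x} ⊆ ⋂ i ∈ Finset.univ, X i ⁻¹' Set.Iic x := by
    intro ω hω
    simp only [Finset.mem_univ, Set.iInter_true, Set.mem_iInter]
    exact fun i ↦ (le_ciSup (Set.finite_range fun i ↦ X i ω).bddAbove i).trans hω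
  refine (measureReal_mono hsub).trans (le_of_eq ?_)
  rw [measureReal_def, hindep.measure_inter_preimage_eq_mul _ fun _ _ ↦ measurableSet_Iic,
    ENNReal.toReal_prod]
  simp only [← measureReal_def, ← map_measureReal_apply (hX _) measurableSet_Iic, hlaw]
  simp

/-- Lower tail of the Gaussian maximum around the quantile `a`. -/
lemma measureReal_iSup_le_sub_le (hn : 2 ≤ n) (hX : ∀ i, Measurable (X i))
    (hindep : iIndepFun X P) (hlaw : ∀ i, P.map (X i) = gaussianReal 0 1) {a s : ℝ}
    (hs : 0 ≤ s) (ha1 : √(log n) ≤ a) (ha2 : a ≤ √8 * √(log n))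
    (ha : (gaussianReal 0 1).real (Set.Ici a) = 1 / (8 * n)) :
    P.real {ω | ⨆ i, X i ω ≤ a - s} ≤ 8 * exp (-(s * √(log n) / 8)) := by
  have hn' : (2 : ℝ) ≤ n := by exact_mod_cast hn
  have hL := sqrt_nonneg (log n)
  have hLs := mul_nonneg hs hL
  refine (measureReal_iSup_le_le hX hindep hlaw _).trans ?_
  rcases le_total s a with hsa | hsa
  · have hG : exp (s * √(log n) / 8) / (8 * n) ≤ (gaussianReal 0 1).real (Set.Ici (a - s)) := by
      have h := gaussianReal_Ici_add_le (a - s) hs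
      rw [sub_add_cancel, ha, ← inv_mul_le_iff₀ (exp_pos _), ← exp_neg, mul_one_div] at h
      refine le_trans ?_ h
      gcongr
      nlinarith [mul_nonneg hs (sub_nonneg.2 ha1), mul_nonneg hs (sub_nonneg.2 hsa)]
    have hE : exp (s * √(log n) / 8) / 8 ≤ n * (gaussianReal 0 1).real (Set.Ici (a - s)) := by
      calc _ = n * (exp (s * √(log n) / 8) / (8 * n)) := by field_simp
        _ ≤ _ := by gcongr
    calc (gaussianReal 0 1).real (Set.Iic (a - s)) ^ n
        ≤ exp (-(gaussianReal 0 1).real (Set.Ici (a - s))) ^ n := by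
          rw [gaussianReal_Iic_eq_one_sub]
          gcongr
          · exact sub_nonneg.2 measureReal_le_one
          · exact one_sub_le_exp_neg _
      _ = (exp (n * (gaussianReal 0 1).real (Set.Ici (a - s))))⁻¹ := by
          rw [← exp_nat_mul, ← exp_neg]; ring_nf
      _ ≤ (exp (s * √(log n) / 8) / 8)⁻¹ := by
          gcongr
          exact hE.trans ((lt_add_one _).le.trans (add_one_le_exp _))
      _ = 8 * exp (-(s * √(log n) / 8)) := by rw [inv_div, exp_neg]; rfl
  · have hu := sub_nonneg.2 hsa
    have h8 : √8 ≤ 3 := by rw [sqrt_le_left (by norm_num)]; norm_num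
    have hlog : √(log n) ^ 2 ≤ n := by
      rw [sq_sqrt (log_nonneg (by linarith))]
      exact log_le_self (by linarith)
    have hkey : s * √(log n) / 8 ≤ n * ((s - a) ^ 2 / 2 + log 2) := by
      have h2 := log_two_gt_d9
      nlinarith [mul_le_mul_of_nonneg_right (ha2.trans (mul_le_mul_of_nonneg_right h8 hL)) hL,
        sq_nonneg (s - a - √(log n)), mul_nonneg (sub_nonneg.2 hn') (sq_nonneg (s - a))]
    calc (gaussianReal 0 1).real (Set.Iic (a - s)) ^ n ≤ (exp (-((s - a) ^ 2 / 2)) / 2) ^ n := by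
          rw [gaussianReal_Iic_eq, neg_sub]
          gcongr
          exact gaussianReal_Ici_le hu
      _ = exp (-(n * ((s - a) ^ 2 / 2 + log 2))) := by
          rw [← mul_neg, exp_nat_mul, neg_add, exp_add, exp_neg (log 2), exp_log two_pos]
          rfl
      _ ≤ exp (-(s * √(log n) / 8)) := by gcongr
      _ ≤ 8 * exp (-(s * √(log n) / 8)) := by linarith [exp_pos (-(s * √(log n) / 8))]

/-- Two-sided tail of the Gaussian maximum around the quantile `a`. -/
lemma measureReal_le_abs_iSup_sub_le (hn : 2 ≤ n) (hX : ∀ i, Measurable (X i))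
    (hindep : iIndepFun X P) (hlaw : ∀ i, P.map (X i) = gaussianReal 0 1) {a s : ℝ}
    (hs : 0 ≤ s) (ha1 : √(log n) ≤ a) (ha2 : a ≤ √8 * √(log n))
    (ha : (gaussianReal 0 1).real (Set.Ici a) = 1 / (8 * n)) :
    P.real {ω | s ≤ |(⨆ i, X i ω) - a|} ≤ 9 * exp (-(s * √(log n) / 8)) := by
  have hn' : (2 : ℝ) ≤ n := by exact_mod_cast hn
  have hupper : P.real {ω | a + s ≤ ⨆ i, X i ω} ≤ exp (-(s * √(log n) / 8)) := by
    refine (measureReal_le_iSup_le (by lia) hX hlaw _).trans ?_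
    have hE : exp (-(a * s) - s ^ 2 / 2) ≤ exp (-(s * √(log n) / 8)) := by
      gcongr
      nlinarith [mul_nonneg hs (sub_nonneg.2 ha1), mul_nonneg hs (sqrt_nonneg (log n))]
    calc (n : ℝ) * (gaussianReal 0 1).real (Set.Ici (a + s))
        ≤ n * (exp (-(a * s) - s ^ 2 / 2) * (1 / (8 * n))) := by
          rw [← ha]
          gcongr
          exact gaussianReal_Ici_add_le a hs
      _ = exp (-(a * s) - s ^ 2 / 2) / 8 := by field_simp
      _ ≤ _ := by linarith [exp_pos (-(a * s) - s ^ 2 / 2)]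
  have hlower := measureReal_iSup_le_sub_le hn hX hindep hlaw hs ha1 ha2 ha
  have hsub : {ω | s ≤ |(⨆ i, X i ω) - a|} ⊆
      {ω | a + s ≤ ⨆ i, X i ω} ∪ {ω | ⨆ i, X i ω ≤ a - s} := by
    intro ω hω
    rcases le_abs.1 (show s ≤ |(⨆ i, X i ω) - a| from hω) with h | h
    · exact Or.inl (show a + s ≤ ⨆ i, X i ω by linarith)
    · exact Or.inr (show ⨆ i, X i ω ≤ a - s by linarith)
  linarith [(measureReal_mono hsub).trans (measureReal_union_le (μ := P) _ _)]

end Maximum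

/-- A variable with exponential tails around some point has its mean close to that point. -/
lemma abs_integral_sub_le_of_exp_tail {Ω : Type*} [MeasurableSpace Ω] {P : Measure Ω}
    [IsProbabilityMeasure P] {Y : Ω → ℝ} (hY : Measurable Y) {a C r : ℝ} (hC : 0 ≤ C)
    (hr : 0 < r) (htail : ∀ s, 0 ≤ s → P.real {ω | s ≤ |Y ω - a|} ≤ C * exp (-(s * r))) :
    |(∫ ω, Y ω ∂P) - a| ≤ C / r := by
  have hint : IntegrableOn (fun s ↦ C * exp (-r * s)) (Set.Ioi 0) :=
    (integrableOn_exp_mul_Ioi (neg_lt_zero.2 hr) 0).const_mul C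
  have hlint : ∫⁻ ω, ENNReal.ofReal |Y ω - a| ∂P ≤ ENNReal.ofReal (C / r) := by
    rw [lintegral_eq_lintegral_meas_le P (.of_forall fun ω ↦ abs_nonneg _) (by fun_prop)]
    calc ∫⁻ s in Set.Ioi 0, P {ω | s ≤ |Y ω - a|}
        ≤ ∫⁻ s in Set.Ioi 0, ENNReal.ofReal (C * exp (-r * s)) := by
          refine setLIntegral_mono' measurableSet_Ioi fun s hs ↦ ?_
          rw [← ofReal_measureReal]
          refine ENNReal.ofReal_le_ofReal ((htail s (le_of_lt hs)).trans (le_of_eq ?_))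
          ring_nf
      _ = ENNReal.ofReal (C / r) := by
          rw [← ofReal_integral_eq_lintegral_ofReal hint (.of_forall fun s ↦ by positivity),
            integral_const_mul, integral_exp_mul_Ioi (neg_lt_zero.2 hr)]
          simp [div_eq_mul_inv]
  have hYa : Integrable (fun ω ↦ Y ω - a) P := by
    refine ⟨by fun_prop, ?_⟩
    rw [hasFiniteIntegral_iff_norm]
    exact hlint.trans_lt ENNReal.ofReal_lt_top
  have hYint : Integrable Y P := by
    simpa only [Pi.add_def, sub_add_cancel] using hYa.add (integrable_const a)
  calc |(∫ ω, Y ω ∂P) - a| = |∫ ω, (Y ω - a) ∂P| := by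
        rw [integral_sub hYint (integrable_const a)]; simp
    _ ≤ ∫ ω, |Y ω - a| ∂P := abs_integral_le_integral_abs
    _ ≤ C / r := by
      rw [integral_eq_lintegral_of_nonneg_ae (.of_forall fun ω ↦ abs_nonneg _) (by fun_prop)]
      exact ENNReal.toReal_le_of_le_ofReal (by positivity) hlint

/-- **Superconcentration for i.i.d. standard Gaussians** (Tanguy, inequality (1.6) / `Indc`).
There is a universal constant `c > 0` such that for any `n ≥ 2` and any i.i.d. standard
normal random variables `X_1, …, X_n` with maximum `M_n = max_i X_i`, one has
`P(|M_n − E[M_n]| ≥ t) ≤ 6 e^{−c t √(log n)}` for all `t ≥ 0`. -/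
theorem iid_gaussian_maximum_superconcentration :
    ∃ c : ℝ, 0 < c ∧
      ∀ (Ω : Type) (_ : MeasurableSpace Ω) (P : Measure Ω), IsProbabilityMeasure P →
      ∀ (n : ℕ), 2 ≤ n →
      ∀ (X : Fin n → Ω → ℝ), (∀ i, Measurable (X i)) →
      iIndepFun X P →
      (∀ i, P.map (X i) = gaussianReal 0 1) →
      ∀ t : ℝ, 0 ≤ t →
        (P {ω | t ≤ |(⨆ i, X i ω) - ∫ ω', (⨆ i, X i ω') ∂P|}).toReal ≤
          6 * Real.exp (-c * t * Real.sqrt (Real.log n)) := by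
  refine ⟨1 / 64, by norm_num, fun Ω _ P _ n hn X hX hindep hlaw t ht ↦ ?_⟩
  obtain ⟨a, ha1, ha2, ha⟩ := exists_gaussianReal_Ici_eq hn
  have htail := fun s (hs : 0 ≤ s) ↦
    measureReal_le_abs_iSup_sub_le hn hX hindep hlaw hs ha1 ha2 ha
  have hL : 0 < √(log n) := sqrt_pos.2 (log_pos (by exact_mod_cast hn))
  have hmean : |(∫ ω, (⨆ i, X i ω) ∂P) - a| ≤ 72 / √(log n) := by
    refine (abs_integral_sub_le_of_exp_tail (.iSup hX) (C := 9) (r := √(log n) / 8)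
      (by norm_num) (by positivity) fun s hs ↦ ?_).trans (le_of_eq (by field_simp; norm_num))
    rw [← mul_div_assoc]
    exact htail s hs
  rw [← measureReal_def]
  set m := ∫ ω, (⨆ i, X i ω) ∂P
  have h6 : exp (3 / 2) ≤ 6 := by
    have h1 : exp (3 / 2) ^ 2 = exp 1 ^ 3 := by
      rw [← exp_nat_mul, ← exp_nat_mul]; norm_num
    have h2 : exp 1 ^ 3 ≤ 2.72 ^ 3 := by
      gcongr
      linarith [exp_one_lt_d9]
    exact le_of_sq_le_sq (by linarith) (by norm_num)
  have h6' : exp (3 / 2 - t * √(log n) / 64) ≤ 6 * exp (-(1 / 64) * t * √(log n)) := by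
    rw [sub_eq_add_neg, exp_add, show -(t * √(log n) / 64) = -(1 / 64) * t * √(log n) by ring]
    gcongr
  refine le_trans ?_ h6'
  rcases le_total (t * √(log n)) 96 with hsmall | hlarge
  · exact measureReal_le_one.trans (one_le_exp (by linarith))
  · have hδ : 72 / √(log n) ≤ t := by
      rw [div_le_iff₀ hL]; linarith
    have hsub : {ω | t ≤ |(⨆ i, X i ω) - m|} ⊆
        {ω | t - 72 / √(log n) ≤ |(⨆ i, X i ω) - a|} := by
      intro ω hω
      have h1 : t ≤ |(⨆ i, X i ω) - m| := hω
      have h2 := abs_sub_le (⨆ i, X i ω) a m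
      rw [abs_sub_comm a m] at h2
      exact show t - 72 / √(log n) ≤ |(⨆ i, X i ω) - a| by linarith
    have h9 : (9 : ℝ) ≤ exp 3 := by
      have h : exp 3 = exp 1 ^ 3 := by rw [← exp_nat_mul]; norm_num
      have h2 : (2.7 : ℝ) ^ 3 ≤ exp 1 ^ 3 := by
        gcongr
        linarith [exp_one_gt_d9]
      linarith
    calc P.real {ω | t ≤ |(⨆ i, X i ω) - m|}
        ≤ 9 * exp (-((t - 72 / √(log n)) * √(log n) / 8)) :=
          (measureReal_mono hsub).trans (htail _ (sub_nonneg.2 hδ))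
      _ ≤ exp 3 * exp (9 - t * √(log n) / 8) := by
          rw [sub_mul, div_mul_cancel₀ _ hL.ne']
          gcongr
          linarith
      _ ≤ exp (3 / 2 - t * √(log n) / 64) := by
          rw [← exp_add]
          gcongr
          linarith
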